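/- Let A be a finite nonempty type, r : A → ℝ, and for logits z : A → ℝ let π_z be the softmax policy, H(z) = -∑_a π_z(a) · log π_z(a) the entropy, J(z) = ∑_a π_z(a) · r(a) the expected reward, and A_z(a) = r(a) - J(z) the advantage. Then for every learning rate η ∈ ℝ, the Fréchet derivative of H at z applied to the policy-gradient update direction Δ(a) = η · π_z(a) · A_z(a) equals -η · Cov_{π_z}(a ↦ log π_z(a), a ↦ π_z(a) · A_z(a)). -/

import Mathlib

/-- Softmax policy induced by logits `z`. -/
noncomputable def softmax {A : Type*} [Fintype A] (z : A → ℝ) (a : A) : ℝ :=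
  Real.exp (z a) / ∑ a', Real.exp (z a')

/-- Shannon entropy of the softmax policy. -/
noncomputable def entropy {A : Type*} [Fintype A] (z : A → ℝ) : ℝ :=
  -∑ a, softmax z a * Real.log (softmax z a)

/-- Expected reward of the softmax policy. -/
noncomputable def expReward {A : Type*} [Fintype A] (r : A → ℝ) (z : A → ℝ) : ℝ :=
  ∑ a, softmax z a * r a

/-- Advantage of action `a` under the softmax policy with logits `z`. -/
noncomputable def advantage {A : Type*} [Fintype A] (r : A → ℝ) (z : A → ℝ) (a : A) : ℝ :=
  r a - expReward r z

/-- Covariance of `f` and `g` under the probability vector `p`. -/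
noncomputable def cov {A : Type*} [Fintype A] (p f g : A → ℝ) : ℝ :=
  ∑ a, p a * (f a - ∑ a', p a' * f a') * (g a - ∑ a', p a' * g a')

section SoftmaxCalculus

variable {A : Type*} [Fintype A]

theorem sum_exp_pos [Nonempty A] (z : A → ℝ) : 0 < ∑ a, Real.exp (z a) :=
  Finset.sum_pos (fun _ _ => Real.exp_pos _) Finset.univ_nonempty

theorem sum_softmax [Nonempty A] (z : A → ℝ) : ∑ a, softmax z a = 1 := by
  simp only [softmax, ← Finset.sum_div]
  exact div_self (sum_exp_pos z).ne'

theorem log_softmax [Nonempty A] (z : A → ℝ) (a : A) :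
    Real.log (softmax z a) = z a - Real.log (∑ a', Real.exp (z a')) := by
  rw [softmax, Real.log_div (Real.exp_ne_zero _) (sum_exp_pos z).ne', Real.log_exp]

theorem softmax_pos [Nonempty A] (z : A → ℝ) (a : A) : 0 < softmax z a :=
  div_pos (Real.exp_pos _) (sum_exp_pos z)

/-- The derivative of `z ↦ log (softmax z a)`: the coordinate `a` centred by its policy mean. -/
noncomputable def scoreCLM (z : A → ℝ) (a : A) : (A → ℝ) →L[ℝ] ℝ :=
  (ContinuousLinearMap.proj a : (A → ℝ) →L[ℝ] ℝ) -
    ∑ b, softmax z b • (ContinuousLinearMap.proj b : (A → ℝ) →L[ℝ] ℝ)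

theorem scoreCLM_apply (z : A → ℝ) (a : A) (v : A → ℝ) :
    scoreCLM z a v = v a - ∑ b, softmax z b * v b := by
  simp [scoreCLM]

theorem hasFDerivAt_log_softmax [Nonempty A] (z : A → ℝ) (a : A) :
    HasFDerivAt (fun w : A → ℝ => Real.log (softmax w a)) (scoreCLM z a) z := by
  have hcoord (b : A) : HasFDerivAt (fun w : A → ℝ => w b)
      (ContinuousLinearMap.proj b : (A → ℝ) →L[ℝ] ℝ) z := hasFDerivAt_apply b z
  have hsum := (HasFDerivAt.fun_sum fun b (_ : b ∈ Finset.univ) => (hcoord b).exp).log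
    (sum_exp_pos z).ne'
  simp only [log_softmax]
  refine ((hcoord a).sub hsum).congr_fderiv ?_
  ext v
  simp [scoreCLM, softmax, Finset.mul_sum, div_eq_inv_mul, mul_assoc]

theorem hasFDerivAt_softmax [Nonempty A] (z : A → ℝ) (a : A) :
    HasFDerivAt (fun w : A → ℝ => softmax w a) (softmax z a • scoreCLM z a) z := by
  simpa only [Real.exp_log (softmax_pos _ a)] using (hasFDerivAt_log_softmax z a).exp

theorem hasFDerivAt_entropy [Nonempty A] (z : A → ℝ) :
    HasFDerivAt entropy
      (-∑ a, (softmax z a • scoreCLM z a +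
        Real.log (softmax z a) • softmax z a • scoreCLM z a)) z :=
  (HasFDerivAt.fun_sum fun a (_ : a ∈ Finset.univ) =>
    (hasFDerivAt_softmax z a).mul (hasFDerivAt_log_softmax z a)).neg

theorem sum_mul_sub_mean {p : A → ℝ} (hp : ∑ a, p a = 1) (g : A → ℝ) :
    ∑ a, p a * (g a - ∑ b, p b * g b) = 0 := by
  simp only [mul_sub, Finset.sum_sub_distrib, ← Finset.sum_mul, hp, one_mul, sub_self]

theorem cov_eq_sum_mul_sub_mean {p : A → ℝ} (hp : ∑ a, p a = 1) (f g : A → ℝ) :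
    cov p f g = ∑ a, f a * (p a * (g a - ∑ b, p b * g b)) := by
  have h : cov p f g = ∑ a, f a * (p a * (g a - ∑ b, p b * g b)) -
      (∑ b, p b * f b) * ∑ a, p a * (g a - ∑ b, p b * g b) := by
    rw [cov, Finset.mul_sum, ← Finset.sum_sub_distrib]
    exact Finset.sum_congr rfl fun a _ => by ring
  rw [h, sum_mul_sub_mean hp, mul_zero, sub_zero]

theorem fderiv_entropy_apply [Nonempty A] (z v : A → ℝ) :
    fderiv ℝ entropy z v = -cov (softmax z) (fun a => Real.log (softmax z a)) v := by
  rw [(hasFDerivAt_entropy z).fderiv, cov_eq_sum_mul_sub_mean (sum_softmax z)]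
  simp [scoreCLM_apply, Finset.sum_add_distrib, sum_mul_sub_mean (sum_softmax z)]

end SoftmaxCalculus

/-- Entropy dynamics under policy gradient: the Fréchet derivative of the entropy at `z`
applied to the policy-gradient update direction `Δ(a) = η · π_z(a) · A_z(a)` equals
`-η · Cov_{π_z}(log π_z, π_z · A_z)`. -/
theorem entropy_dynamics_policyGradient {A : Type*} [Fintype A] [Nonempty A]
    (r : A → ℝ) (z : A → ℝ) (η : ℝ) :
    fderiv ℝ entropy z (fun a => η * (softmax z a * advantage r z a)) =
      -(η * cov (softmax z) (fun a => Real.log (softmax z a))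
          (fun a => softmax z a * advantage r z a)) := by
  have hlin : (fun a => η * (softmax z a * advantage r z a)) =
      η • fun a => softmax z a * advantage r z a := rfl
  rw [hlin, map_smul, fderiv_entropy_apply, smul_eq_mul, mul_neg]
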